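/- arXiv:1911.10733 — 2 statements merged into one kernel-verified Lean document; each statement's English description precedes it below -/
import Mathlib

section
/- Let A₁, …, Aₙ be positive invertible operators on H with mI ≤ Aⱼ ≤ MI (j = 1, …, n) for some scalars 0 < m < M, let Φ : B(H) → B(K) be a unital positive linear map, let h = M/m, and let F (on H) and G (on K) each satisfy the arithmetic–harmonic sandwich for the probability vector ω. Then for every r ∈ (0, 1), (4Mm/(M + m)²)·K(h, −r)⁻¹·Φ(F(A₁, …, Aₙ)ʳ) ≤ G(Φ(A₁ʳ), …, Φ(Aₙʳ)). -/
noncomputable section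

/-- The arithmetic–harmonic sandwich for the probability vector `ω`:
`(∑ ωⱼ Bⱼ⁻¹)⁻¹ ≤ F (B₁, …, Bₙ) ≤ ∑ ωⱼ Bⱼ` for all positive invertible `B₁, …, Bₙ`,
and `F` takes values in the positive invertible operators. -/
def IsAHSandwich {E : Type*} [NormedAddCommGroup E] [InnerProductSpace ℂ E]
    [CompleteSpace E] {n : ℕ} (ω : Fin n → ℝ)
    (F : (Fin n → (E →L[ℂ] E)) → (E →L[ℂ] E)) : Prop :=
  ∀ B : Fin n → (E →L[ℂ] E), (∀ j, 0 ≤ B j) → (∀ j, IsUnit (B j)) →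
    (0 ≤ F B ∧ IsUnit (F B)) ∧
    Ring.inverse (∑ j, ω j • Ring.inverse (B j)) ≤ F B ∧
    F B ≤ ∑ j, ω j • B j

/-- The generalized Kantorovich constant `K(h, p)`, with `K(h, 0) = K(h, 1) = 1`. -/
def Kconst (h p : ℝ) : ℝ :=
  if p = 0 ∨ p = 1 then 1
  else ((h ^ p - h) / ((p - 1) * (h - 1))) *
    (((p - 1) / p) * ((h ^ p - 1) / (h ^ p - h))) ^ p

section Scalar

open Real

/-- Weighted arithmetic–geometric mean inequality in the form
`(β - α x) x ^ r ≤ β / (1 + r) * ((1 + r) / r * (α / β)) ^ (-r)`. -/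
lemma affine_mul_rpow_le {α β x r : ℝ} (hα : 0 < α) (hβ : 0 < β) (hx : 0 < x)
    (hq : 0 ≤ β - α * x) (hr : 0 < r) :
    (β - α * x) * x ^ r ≤ β / (1 + r) * ((1 + r) / r * (α / β)) ^ (-r) := by
  have h1r : 0 < 1 + r := by linarith
  have hc : 0 < α * x / r := by positivity
  have amgm := geom_mean_le_arith_mean2_weighted (w₁ := 1 / (1 + r)) (w₂ := r / (1 + r))
    (by positivity) (by positivity) hq hc.le (by field_simp)
  have hmean : 1 / (1 + r) * (β - α * x) + r / (1 + r) * (α * x / r) = β / (1 + r) := by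
    field_simp
    ring
  rw [hmean] at amgm
  have hpow := rpow_le_rpow (by positivity) amgm h1r.le
  rw [mul_rpow (by positivity) (by positivity), ← rpow_mul hq, ← rpow_mul hc.le,
    one_div_mul_cancel h1r.ne', div_mul_cancel₀ _ h1r.ne', rpow_one] at hpow
  have hxr : x ^ r = (α * x / r) ^ r * (r / α) ^ r := by
    rw [← mul_rpow hc.le (by positivity)]
    congr 1
    field_simp
  have hβr : ((1 + r) / r * (α / β)) ^ (-r) = (β / (1 + r)) ^ r * (r / α) ^ r := by
    rw [rpow_neg (by positivity), ← inv_rpow (by positivity),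
      ← mul_rpow (by positivity) (by positivity)]
    congr 1
    field_simp
  rw [hxr, hβr, ← mul_assoc, ← mul_assoc]
  have hsplit : (β / (1 + r)) ^ (1 + r) = β / (1 + r) * (β / (1 + r)) ^ r := by
    rw [rpow_add (by positivity), rpow_one]
  rw [hsplit] at hpow
  exact mul_le_mul_of_nonneg_right hpow (by positivity)

lemma Kconst_neg_eq {h r : ℝ} (hh : 1 < h) (hr : 0 < r) :
    Kconst h (-r) = ((h - h ^ (-r)) / (h - 1)) / (1 + r) *
      ((1 + r) / r * (((1 - h ^ (-r)) / (h - 1)) / ((h - h ^ (-r)) / (h - 1)))) ^ (-r) := by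
  have hu : h ^ (-r) < 1 := rpow_lt_one_of_one_lt_of_neg hh (by linarith)
  have h1 : h - 1 ≠ 0 := by linarith
  have h2 : h - h ^ (-r) ≠ 0 := by linarith
  have h3 : h ^ (-r) - h ≠ 0 := by linarith
  have h4 : -r - 1 ≠ 0 := by linarith
  have h5 : 1 + r ≠ 0 := by linarith
  rw [Kconst, if_neg (by rintro (h | h) <;> linarith)]
  congr 1
  · rw [div_div, div_eq_div_iff (mul_ne_zero h4 h1) (mul_ne_zero h1 h5)]
    ring
  · congr 1
    rw [div_div_div_cancel_right₀ h1]
    congr 1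
    · rw [div_eq_div_iff (by linarith) hr.ne']
      ring
    · rw [div_eq_div_iff h3 h2]
      ring

lemma Kconst_neg_pos {h r : ℝ} (hh : 1 < h) (hr : 0 < r) : 0 < Kconst h (-r) := by
  have hu : h ^ (-r) < 1 := rpow_lt_one_of_one_lt_of_neg hh (by linarith)
  rw [Kconst_neg_eq hh hr]
  have h1 : 0 < h - 1 := by linarith
  have h2 : 0 < h - h ^ (-r) := by linarith
  have h3 : 0 < 1 - h ^ (-r) := by linarith
  positivity

/-- The power function is dominated by `K(h, -r)` times its chord on `[1, h]`. -/
lemma rpow_le_Kconst_mul_chord {h r x : ℝ} (hh : 1 < h) (hr : 0 < r) (hx : x ∈ Set.Icc 1 h) :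
    x ^ r ≤ Kconst h (-r) * (1 + (h ^ r - 1) / (h - 1) * (x - 1)) := by
  have hu : 1 < h ^ r := one_lt_rpow hh hr
  have hneg : h ^ (-r) = (h ^ r)⁻¹ := rpow_neg (by linarith) r
  have hK := Kconst_neg_eq hh hr
  have hKpos := Kconst_neg_pos hh hr
  rw [hneg] at hK
  generalize h ^ r = u at *
  have hui : u⁻¹ < 1 := inv_lt_one_of_one_lt₀ hu
  have h1 : 0 < h - 1 := by linarith
  have h2 : 0 < h - u⁻¹ := by linarith
  have h3 : 0 < 1 - u⁻¹ := by linarith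
  obtain ⟨s, rfl⟩ : ∃ s, x = 1 + s * (h - 1) := ⟨(x - 1) / (h - 1), by field_simp; ring⟩
  have hs0 : 0 ≤ s := by
    have := hx.1
    exact nonneg_of_mul_nonneg_left (by linarith) h1
  have hs1 : s ≤ 1 := by
    have := hx.2
    exact le_of_mul_le_mul_right (by linarith) h1
  have hqeq : (h - u⁻¹) / (h - 1) - (1 - u⁻¹) / (h - 1) * (1 + s * (h - 1)) =
      1 - s * (1 - u⁻¹) := by
    field_simp
    ring
  have hq : 0 < 1 - s * (1 - u⁻¹) := by
    have : 0 < u⁻¹ := by positivity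
    nlinarith
  have key := affine_mul_rpow_le (α := (1 - u⁻¹) / (h - 1)) (β := (h - u⁻¹) / (h - 1))
    (x := 1 + s * (h - 1)) (r := r) (by positivity) (by positivity) (by positivity)
    (by rw [hqeq]; exact hq.le) hr
  rw [← hK, hqeq] at key
  have hpq : 1 ≤ (1 + s * (u - 1)) * (1 - s * (1 - u⁻¹)) := by
    have : (1 + s * (u - 1)) * (1 - s * (1 - u⁻¹)) = 1 + s * (1 - s) * ((u - 1) ^ 2 / u) := by
      field_simp
      ring
    rw [this]
    have : 0 ≤ s * (1 - s) := mul_nonneg hs0 (by linarith)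
    have : 0 ≤ (u - 1) ^ 2 / u := by positivity
    nlinarith
  have hchord : 1 + (u - 1) / (h - 1) * (1 + s * (h - 1) - 1) = 1 + s * (u - 1) := by
    field_simp
    ring
  rw [hchord]
  refine le_of_mul_le_mul_left ?_ hq
  calc _ ≤ Kconst h (-r) * 1 := by simpa using key
    _ ≤ Kconst h (-r) * ((1 + s * (u - 1)) * (1 - s * (1 - u⁻¹))) := by gcongr
    _ = _ := by ring

/-- The power function is dominated by `K(M / m, -r)` times its chord on `[m, M]`. -/
lemma rpow_le_Kconst_mul_chord_Icc {m M r t : ℝ} (hm : 0 < m) (hmM : m < M) (hr : 0 < r)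
    (ht : t ∈ Set.Icc m M) :
    t ^ r ≤ Kconst (M / m) (-r) * (m ^ r + (M ^ r - m ^ r) / (M - m) * (t - m)) := by
  have hM : 0 < M := hm.trans hmM
  have ht0 : 0 < t := hm.trans_le ht.1
  have hmr : 0 < m ^ r := rpow_pos_of_pos hm r
  have key := rpow_le_Kconst_mul_chord (h := M / m) (x := t / m) ((one_lt_div hm).2 hmM) hr
    ⟨(one_le_div hm).2 ht.1, by gcongr; exact ht.2⟩
  rw [div_rpow ht0.le hm.le, div_rpow hM.le hm.le, div_le_iff₀ hmr] at key
  refine key.trans_eq ?_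
  have : M - m ≠ 0 := by linarith
  have : M / m - 1 ≠ 0 := by
    rw [div_sub_one hm.ne']
    positivity
  rw [mul_assoc]
  congr 1
  field_simp

/-- A concave power lies above its chord on `[m, M]`. -/
lemma chord_le_rpow {m M r t : ℝ} (hm : 0 < m) (hmM : m < M) (hr0 : 0 ≤ r) (hr1 : r ≤ 1)
    (ht : t ∈ Set.Icc m M) :
    m ^ r + (M ^ r - m ^ r) / (M - m) * (t - m) ≤ t ^ r := by
  have hd : 0 < M - m := by linarith
  have key := (concaveOn_rpow hr0 hr1).2 (Set.mem_Ici.2 hm.le)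
    (Set.mem_Ici.2 (hm.trans hmM).le)
    (div_nonneg (by linarith [ht.2]) hd.le : 0 ≤ (M - t) / (M - m))
    (div_nonneg (by linarith [ht.1]) hd.le : 0 ≤ (t - m) / (M - m))
    (by field_simp; ring)
  have e : ((M - t) / (M - m)) • m + ((t - m) / (M - m)) • M = t := by
    simp only [smul_eq_mul]
    field_simp
    ring
  rw [e] at key
  refine le_of_eq_of_le ?_ key
  simp only [smul_eq_mul]
  field_simp
  ring

/-- The ratio of harmonic to arithmetic means decreases with the spread of the endpoints. -/
lemma kantorovich_le_kantorovich_rpow {m M r : ℝ} (hm : 0 < m) (hmM : m < M)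
    (hr0 : 0 ≤ r) (hr1 : r ≤ 1) :
    4 * M * m / (M + m) ^ 2 ≤ 4 * M ^ r * m ^ r / (M ^ r + m ^ r) ^ 2 := by
  have hM : 0 < M := hm.trans hmM
  have ha : 0 < m ^ r := rpow_pos_of_pos hm r
  have hb : 0 < M ^ r := rpow_pos_of_pos hM r
  have hab : m ^ r ≤ M ^ r := rpow_le_rpow hm.le hmM.le hr0
  have h1 : m * m ^ r ≤ M * M ^ r := mul_le_mul hmM.le hab ha.le hM.le
  have h2 : m * M ^ r ≤ M * m ^ r := by
    have e : ∀ t : ℝ, 0 < t → t = t ^ r * t ^ (1 - r) := fun t ht => by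
      rw [← rpow_add ht, add_sub_cancel, rpow_one]
    have h3 : m ^ (1 - r) ≤ M ^ (1 - r) := rpow_le_rpow hm.le hmM.le (by linarith)
    calc m * M ^ r = m ^ r * M ^ r * m ^ (1 - r) := by
          nth_rewrite 1 [e m hm]
          ring
      _ ≤ m ^ r * M ^ r * M ^ (1 - r) := by gcongr
      _ = M * m ^ r := by
          nth_rewrite 3 [e M hM]
          ring
  rw [div_le_div_iff₀ (by positivity) (by positivity)]
  nlinarith [mul_nonneg (sub_nonneg.2 h1) (sub_nonneg.2 h2)]

end Scalar

section CStar

variable {A : Type*} [CStarAlgebra A]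

lemma cfc_affine (α β : ℝ) {T : A} (hT : IsSelfAdjoint T) :
    cfc (fun t : ℝ => α * t + β) T = α • T + β • (1 : A) := by
  rw [cfc_add_const β (fun t : ℝ => α * t) T, cfc_const_mul_id α T,
    Algebra.algebraMap_eq_smul_one]

lemma continuousOn_rpow_spectrum {r : ℝ} (hr : 0 ≤ r) (T : A) :
    ContinuousOn (fun t : ℝ => t ^ r) (spectrum ℝ T) :=
  (Real.continuous_rpow_const hr).continuousOn

lemma continuousOn_inv_spectrum {T : A} (hu : IsUnit T) :
    ContinuousOn (fun t : ℝ => t⁻¹) (spectrum ℝ T) :=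
  continuousOn_inv₀.mono fun t ht h0 =>
    spectrum.zero_notMem ℝ hu ((show t = 0 from h0) ▸ ht)

lemma sum_smul_affine {ι : Type*} [Fintype ι] {ω : ι → ℝ} (hω1 : ∑ j, ω j = 1) (α β : ℝ)
    (X : ι → A) :
    ∑ j, ω j • (α • X j + β • (1 : A)) = α • ∑ j, ω j • X j + β • (1 : A) := by
  simp only [smul_add, Finset.sum_add_distrib]
  rw [← Finset.sum_smul, hω1, one_smul, Finset.smul_sum]
  simp only [smul_comm α]

variable [PartialOrder A] [StarOrderedRing A]

lemma nonneg_of_smul_one_le {m : ℝ} (hm : 0 ≤ m) {T : A} (h : m • (1 : A) ≤ T) : 0 ≤ T :=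
  (smul_nonneg hm zero_le_one).trans h

lemma isUnit_of_smul_one_le {m : ℝ} (hm : 0 < m) {T : A} (h : m • (1 : A) ≤ T) : IsUnit T := by
  refine CStarAlgebra.isUnit_of_le (m • (1 : A)) h ?_
  rw [← Algebra.algebraMap_eq_smul_one]
  exact (IsUnit.mk0 m hm.ne').map (algebraMap ℝ A) |>.isStrictlyPositive
    (by rw [Algebra.algebraMap_eq_smul_one]; exact smul_nonneg hm.le zero_le_one)

lemma le_of_mem_spectrum {m : ℝ} {T : A} (hT : 0 ≤ T) (h : m • (1 : A) ≤ T) :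
    ∀ t ∈ spectrum ℝ T, m ≤ t := by
  rw [← Algebra.algebraMap_eq_smul_one] at h
  exact (algebraMap_le_iff_le_spectrum (IsSelfAdjoint.of_nonneg hT)).1 h

lemma spectrum_le_of_le {M : ℝ} {T : A} (hT : 0 ≤ T) (h : T ≤ M • (1 : A)) :
    ∀ t ∈ spectrum ℝ T, t ≤ M := by
  rw [← Algebra.algebraMap_eq_smul_one] at h
  exact (le_algebraMap_iff_spectrum_le (IsSelfAdjoint.of_nonneg hT)).1 h

lemma affine_le_rpow {α β r : ℝ} (hr : 0 ≤ r) {T : A} (hT : 0 ≤ T)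
    (h : ∀ t ∈ spectrum ℝ T, α * t + β ≤ t ^ r) : α • T + β • (1 : A) ≤ CFC.rpow T r := by
  change _ ≤ T ^ r
  rw [← cfc_affine α β (IsSelfAdjoint.of_nonneg hT), CFC.rpow_eq_cfc_real hT]
  exact cfc_mono h (by fun_prop) (continuousOn_rpow_spectrum hr T)

lemma rpow_le_affine {α β r : ℝ} (hr : 0 ≤ r) {T : A} (hT : 0 ≤ T)
    (h : ∀ t ∈ spectrum ℝ T, t ^ r ≤ α * t + β) : CFC.rpow T r ≤ α • T + β • (1 : A) := by
  change T ^ r ≤ _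
  rw [← cfc_affine α β (IsSelfAdjoint.of_nonneg hT), CFC.rpow_eq_cfc_real hT]
  exact cfc_mono h (continuousOn_rpow_spectrum hr T) (by fun_prop)

lemma ring_inverse_eq_cfc {T : A} (hT : 0 ≤ T) (hu : IsUnit T) :
    Ring.inverse T = cfc (fun t : ℝ => t⁻¹) T := by
  obtain ⟨u, rfl⟩ := hu
  rw [Ring.inverse_unit, cfc_inv_id u (IsSelfAdjoint.of_nonneg hT)]

lemma affine_le_ring_inverse {α β : ℝ} {T : A} (hT : 0 ≤ T) (hu : IsUnit T)
    (h : ∀ t ∈ spectrum ℝ T, α * t + β ≤ t⁻¹) : α • T + β • (1 : A) ≤ Ring.inverse T := by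
  rw [← cfc_affine α β (IsSelfAdjoint.of_nonneg hT), ring_inverse_eq_cfc hT hu]
  exact cfc_mono h (by fun_prop) (continuousOn_inv_spectrum hu)

lemma ring_inverse_le_affine {α β : ℝ} {T : A} (hT : 0 ≤ T) (hu : IsUnit T)
    (h : ∀ t ∈ spectrum ℝ T, t⁻¹ ≤ α * t + β) : Ring.inverse T ≤ α • T + β • (1 : A) := by
  rw [← cfc_affine α β (IsSelfAdjoint.of_nonneg hT), ring_inverse_eq_cfc hT hu]
  exact cfc_mono h (continuousOn_inv_spectrum hu) (by fun_prop)

lemma smul_one_le_sum {ι : Type*} [Fintype ι] {ω : ι → ℝ} (hω0 : ∀ j, 0 ≤ ω j)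
    (hω1 : ∑ j, ω j = 1) {c : ℝ} {X : ι → A} (h : ∀ j, c • (1 : A) ≤ X j) :
    c • (1 : A) ≤ ∑ j, ω j • X j := by
  calc c • (1 : A) = ∑ j, ω j • c • (1 : A) := by rw [← Finset.sum_smul, hω1, one_smul]
    _ ≤ _ := Finset.sum_le_sum fun j _ => smul_le_smul_of_nonneg_left (h j) (hω0 j)

lemma sum_le_smul_one {ι : Type*} [Fintype ι] {ω : ι → ℝ} (hω0 : ∀ j, 0 ≤ ω j)
    (hω1 : ∑ j, ω j = 1) {c : ℝ} {X : ι → A} (h : ∀ j, X j ≤ c • (1 : A)) :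
    ∑ j, ω j • X j ≤ c • (1 : A) := by
  calc _ ≤ ∑ j, ω j • c • (1 : A) :=
        Finset.sum_le_sum fun j _ => smul_le_smul_of_nonneg_left (h j) (hω0 j)
    _ = c • (1 : A) := by rw [← Finset.sum_smul, hω1, one_smul]

/-- A reverse arithmetic–harmonic mean inequality: the weighted harmonic mean of operators with
spectra in `[a, b]` dominates `4ab / (a + b)²` times their weighted arithmetic mean. -/
lemma smul_sum_le_harmonic {ι : Type*} [Fintype ι] {ω : ι → ℝ} (hω0 : ∀ j, 0 ≤ ω j)
    (hω1 : ∑ j, ω j = 1) {a b : ℝ} (ha : 0 < a) (hab : a ≤ b) {X : ι → A}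
    (hX1 : ∀ j, a • (1 : A) ≤ X j) (hX2 : ∀ j, X j ≤ b • (1 : A)) :
    (4 * b * a / (b + a) ^ 2) • ∑ j, ω j • X j ≤
      Ring.inverse (∑ j, ω j • Ring.inverse (X j)) := by
  have hb : 0 < b := ha.trans_le hab
  have hX0 j : 0 ≤ X j := nonneg_of_smul_one_le ha.le (hX1 j)
  have hXu j : IsUnit (X j) := isUnit_of_smul_one_le ha (hX1 j)
  have hspec1 j := le_of_mem_spectrum (hX0 j) (hX1 j)
  have hspec2 j := spectrum_le_of_le (hX0 j) (hX2 j)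
  set D := ∑ j, ω j • Ring.inverse (X j) with hD
  have hDlow : b⁻¹ • (1 : A) ≤ D := smul_one_le_sum hω0 hω1 fun j => by
    have := affine_le_ring_inverse (α := 0) (β := b⁻¹) (hX0 j) (hXu j) fun t ht => by
      have := ha.trans_le (hspec1 j t ht)
      rw [zero_mul, zero_add]
      exact inv_anti₀ this (hspec2 j t ht)
    simpa using this
  have hDup : D ≤ (-(a * b)⁻¹) • ∑ j, ω j • X j + ((a + b) / (a * b)) • (1 : A) := by
    rw [← sum_smul_affine hω1]
    refine Finset.sum_le_sum fun j _ => smul_le_smul_of_nonneg_left ?_ (hω0 j)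
    refine ring_inverse_le_affine (hX0 j) (hXu j) fun t ht => ?_
    have h1 := hspec1 j t ht
    have h2 := hspec2 j t ht
    have ht0 : 0 < t := ha.trans_le h1
    have : -(a * b)⁻¹ * t + (a + b) / (a * b) - t⁻¹ = (t - a) * (b - t) / (a * b * t) := by
      field_simp
      ring
    have : 0 ≤ (t - a) * (b - t) / (a * b * t) :=
      div_nonneg (mul_nonneg (by linarith) (by linarith)) (by positivity)
    linarith
  have hD0 := nonneg_of_smul_one_le (by positivity) hDlow
  set l := 2 * a * b / (a + b) with hl
  have hDinv : (-l ^ 2) • D + (2 * l) • (1 : A) ≤ Ring.inverse D := by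
    refine affine_le_ring_inverse hD0 (isUnit_of_smul_one_le (by positivity) hDlow)
      fun t ht => ?_
    have ht0 : 0 < t :=
      (inv_pos.2 hb).trans_le (le_of_mem_spectrum hD0 hDlow t ht)
    have : t⁻¹ - (-l ^ 2 * t + 2 * l) = (l * t - 1) ^ 2 / t := by
      field_simp
      ring
    have : 0 ≤ (l * t - 1) ^ 2 / t := by positivity
    linarith
  refine le_trans ?_ hDinv
  have hmul := smul_le_smul_of_nonneg_left hDup (sq_nonneg l)
  have e1 : l ^ 2 * (-(a * b)⁻¹) = -(4 * b * a / (b + a) ^ 2) := by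
    rw [hl]
    field_simp
    ring
  have e2 : l ^ 2 * ((a + b) / (a * b)) = 2 * l := by
    rw [hl]
    field_simp
  rw [smul_add, smul_smul, smul_smul, e1, e2, neg_smul] at hmul
  rw [neg_smul]
  have := sub_nonneg.2 hmul
  rw [← sub_nonneg]
  convert this using 1
  abel

/-- A reverse Jensen inequality for the power `t ↦ t ^ r`, `0 < r < 1`: the power of a weighted
arithmetic mean is at most `K(M / m, -r)` times the mean of the powers. -/
lemma rpow_sum_le_Kconst_smul_sum {ι : Type*} [Fintype ι] {ω : ι → ℝ} (hω0 : ∀ j, 0 ≤ ω j)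
    (hω1 : ∑ j, ω j = 1) {m M r : ℝ} (hm : 0 < m) (hmM : m < M) (hr0 : 0 < r) (hr1 : r ≤ 1)
    {T : ι → A} (hT1 : ∀ j, m • (1 : A) ≤ T j) (hT2 : ∀ j, T j ≤ M • (1 : A)) :
    CFC.rpow (∑ j, ω j • T j) r ≤ Kconst (M / m) (-r) • ∑ j, ω j • CFC.rpow (T j) r := by
  have hK := Kconst_neg_pos ((one_lt_div hm).2 hmM) hr0
  have hS1 := smul_one_le_sum hω0 hω1 hT1
  have hS2 := sum_le_smul_one hω0 hω1 hT2
  have hS0 := nonneg_of_smul_one_le hm.le hS1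
  set s := (M ^ r - m ^ r) / (M - m) with hs
  have hup : CFC.rpow (∑ j, ω j • T j) r ≤ (Kconst (M / m) (-r) * s) • ∑ j, ω j • T j +
      (Kconst (M / m) (-r) * (m ^ r - s * m)) • (1 : A) := by
    refine rpow_le_affine hr0.le hS0 fun t ht => ?_
    have := rpow_le_Kconst_mul_chord_Icc hm hmM hr0
      ⟨le_of_mem_spectrum hS0 hS1 t ht, spectrum_le_of_le hS0 hS2 t ht⟩
    refine this.trans_eq ?_
    rw [← hs]
    ring
  refine hup.trans ?_
  rw [mul_smul, mul_smul, ← smul_add, ← sum_smul_affine hω1]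
  refine smul_le_smul_of_nonneg_left (Finset.sum_le_sum fun j _ =>
    smul_le_smul_of_nonneg_left ?_ (hω0 j)) hK.le
  have hT0 := nonneg_of_smul_one_le hm.le (hT1 j)
  refine affine_le_rpow hr0.le hT0 fun t ht => ?_
  have := chord_le_rpow hm hmM hr0.le hr1
    ⟨le_of_mem_spectrum hT0 (hT1 j) t ht, spectrum_le_of_le hT0 (hT2 j) t ht⟩
  rw [← hs] at this
  linarith

end CStar

theorem stmt8
    {H K : Type*}
    [NormedAddCommGroup H] [InnerProductSpace ℂ H] [CompleteSpace H]
    [NormedAddCommGroup K] [InnerProductSpace ℂ K] [CompleteSpace K]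
    {n : ℕ} (ω : Fin n → ℝ) (hω0 : ∀ j, 0 ≤ ω j) (hω1 : ∑ j, ω j = 1)
    (m M : ℝ) (hm : 0 < m) (hmM : m < M)
    (A : Fin n → (H →L[ℂ] H))
    (hA0 : ∀ j, 0 ≤ A j) (hAu : ∀ j, IsUnit (A j))
    (hA1 : ∀ j, m • (1 : H →L[ℂ] H) ≤ A j)
    (hA2 : ∀ j, A j ≤ M • (1 : H →L[ℂ] H))
    (Φ : (H →L[ℂ] H) →ₗ[ℂ] (K →L[ℂ] K))
    (hΦ1 : Φ 1 = 1) (hΦpos : ∀ T : H →L[ℂ] H, 0 ≤ T → 0 ≤ Φ T)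
    (F : (Fin n → (H →L[ℂ] H)) → (H →L[ℂ] H))
    (G : (Fin n → (K →L[ℂ] K)) → (K →L[ℂ] K))
    (hF : IsAHSandwich ω F) (hG : IsAHSandwich ω G)
    (r : ℝ) (hr : r ∈ Set.Ioo (0 : ℝ) 1)
    :
    (4 * M * m / (M + m) ^ 2 * (Kconst (M / m) (-r))⁻¹) • Φ (CFC.rpow (F A) r) ≤
      G (fun j => Φ (CFC.rpow (A j) r)) := by
  obtain ⟨hr0, hr1⟩ := hr
  have hM : 0 < M := hm.trans hmM
  have hΦsmul (c : ℝ) (T : H →L[ℂ] H) : Φ (c • T) = c • Φ T := Φ.map_smul_of_tower c T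
  have hΦmono {S T : H →L[ℂ] H} (h : S ≤ T) : Φ S ≤ Φ T := by
    rw [← sub_nonneg, ← map_sub]
    exact hΦpos _ (sub_nonneg.2 h)
  have hX1 j : (m ^ r) • (1 : K →L[ℂ] K) ≤ Φ (CFC.rpow (A j) r) := by
    rw [← hΦ1, ← hΦsmul]
    refine hΦmono ?_
    have := affine_le_rpow (α := 0) (β := m ^ r) hr0.le (hA0 j) fun t ht => by
      rw [zero_mul, zero_add]
      exact Real.rpow_le_rpow hm.le (le_of_mem_spectrum (hA0 j) (hA1 j) t ht) hr0.le
    rwa [zero_smul, zero_add] at this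
  have hX2 j : Φ (CFC.rpow (A j) r) ≤ (M ^ r) • (1 : K →L[ℂ] K) := by
    rw [← hΦ1, ← hΦsmul]
    refine hΦmono ?_
    have := rpow_le_affine (α := 0) (β := M ^ r) hr0.le (hA0 j) fun t ht => by
      rw [zero_mul, zero_add]
      exact Real.rpow_le_rpow (hm.le.trans (le_of_mem_spectrum (hA0 j) (hA1 j) t ht))
        (spectrum_le_of_le (hA0 j) (hA2 j) t ht) hr0.le
    rwa [zero_smul, zero_add] at this
  have ha : 0 < m ^ r := Real.rpow_pos_of_pos hm r
  have hab : m ^ r ≤ M ^ r := Real.rpow_le_rpow hm.le hmM.le hr0.le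
  have hX0 j := nonneg_of_smul_one_le ha.le (hX1 j)
  have hKpos := Kconst_neg_pos ((one_lt_div hm).2 hmM) hr0
  have hlow := (hG _ hX0 fun j => isUnit_of_smul_one_le ha (hX1 j)).2.1
  refine le_trans ?_ ((smul_sum_le_harmonic hω0 hω1 ha hab hX1 hX2).trans hlow)
  have hsum : Φ (CFC.rpow (F A) r) ≤
      Kconst (M / m) (-r) • ∑ j, ω j • Φ (CFC.rpow (A j) r) := by
    have hLH : CFC.rpow (F A) r ≤ CFC.rpow (∑ j, ω j • A j) r :=
      CFC.rpow_le_rpow ⟨hr0.le, hr1.le⟩ (hF A hA0 hAu).2.2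
    have := hΦmono (hLH.trans (rpow_sum_le_Kconst_smul_sum hω0 hω1 hm hmM hr0 hr1.le hA1 hA2))
    simpa only [hΦsmul, map_sum] using this
  have hB0 : 0 ≤ ∑ j, ω j • Φ (CFC.rpow (A j) r) :=
    Finset.sum_nonneg fun j _ => smul_nonneg (hω0 j) (hX0 j)
  calc _ ≤ (4 * M * m / (M + m) ^ 2 * (Kconst (M / m) (-r))⁻¹) •
        Kconst (M / m) (-r) • ∑ j, ω j • Φ (CFC.rpow (A j) r) :=
        smul_le_smul_of_nonneg_left hsum (by positivity)
    _ = (4 * M * m / (M + m) ^ 2) • ∑ j, ω j • Φ (CFC.rpow (A j) r) := by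
        rw [smul_smul, inv_mul_cancel_right₀ hKpos.ne']
    _ ≤ _ := smul_le_smul_of_nonneg_right
        (kantorovich_le_kantorovich_rpow hm hmM hr0.le hr1.le) hB0
end
end

section
/- Let A₁, …, Aₙ be positive invertible operators on H with mI ≤ Aⱼ ≤ MI (j = 1, …, n) for some scalars 0 < m < M, let Φ : B(H) → B(K) be a unital positive linear map, let h = M/m, and let F (on H) and G (on K) each satisfy the arithmetic–harmonic sandwich for the probability vector ω. Then for every α > 0 and every r ≥ 1, G(Φ(A₁ʳ), …, Φ(Aₙʳ)) ≤ α·Φ(F(A₁, …, Aₙ)ʳ) + γ(1/M, 1/m, −r, α·K(h, r)⁻¹)·I. -/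
noncomputable section

/-- The constant `γ(m, M, r, α)`, where real powers are `Real.rpow`. -/
def gammaConst (m M r α : ℝ) : ℝ :=
  if m ≤ ((M ^ r - m ^ r) / (α * r * (M - m))) ^ (1 / (r - 1)) ∧
      ((M ^ r - m ^ r) / (α * r * (M - m))) ^ (1 / (r - 1)) ≤ M then
    α * (r - 1) * ((M ^ r - m ^ r) / (α * r * (M - m))) ^ (r / (r - 1)) +
      (M * m ^ r - m * M ^ r) / (M - m)
  else if M ≤ ((M ^ r - m ^ r) / (α * r * (M - m))) ^ (1 / (r - 1)) then
    (1 - α) * M ^ r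
  else (1 - α) * m ^ r

/-- The slope of the chord of `t ↦ t ^ q` over `[m, M]`. -/
def chordSlope (m M q : ℝ) : ℝ := (M ^ q - m ^ q) / (M - m)

/-- The intercept of the chord of `t ↦ t ^ q` over `[m, M]`. -/
def chordIntercept (m M q : ℝ) : ℝ := (M * m ^ q - m * M ^ q) / (M - m)

section Scalar

theorem rpow_tangent_le {q s t : ℝ} (hq : q < 0 ∨ 1 ≤ q) (hs : 0 < s) (ht : 0 < t) :
    s ^ q + q * s ^ (q - 1) * (t - s) ≤ t ^ q := by
  have bernoulli : 1 + q * (t / s - 1) ≤ (t / s) ^ q := by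
    have hx : 0 < t / s := div_pos ht hs
    rcases hq with hq | hq
    · have h1 := Real.add_one_le_exp (Real.log (t / s) * q)
      rw [← Real.rpow_def_of_pos hx] at h1
      nlinarith [Real.log_le_sub_one_of_pos hx]
    · simpa using one_add_mul_self_le_rpow_one_add (s := t / s - 1) (by linarith) hq
  rw [Real.div_rpow ht.le hs.le, le_div_iff₀ (Real.rpow_pos_of_pos hs q)] at bernoulli
  refine le_of_eq_of_le ?_ bernoulli
  rw [Real.rpow_sub_one hs.ne']
  field_simp

theorem chord_eq_weighted_average {m M q t : ℝ} :
    chordSlope m M q * t + chordIntercept m M q =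
      ((M - t) * m ^ q + (t - m) * M ^ q) / (M - m) := by
  unfold chordSlope chordIntercept
  ring

theorem chord_eq_left {m M q : ℝ} (h : m < M) (t : ℝ) :
    chordSlope m M q * t + chordIntercept m M q = m ^ q + chordSlope m M q * (t - m) := by
  have : M - m ≠ 0 := (sub_pos.2 h).ne'
  unfold chordSlope chordIntercept
  field_simp
  ring

theorem chord_eq_right {m M q : ℝ} (h : m < M) (t : ℝ) :
    chordSlope m M q * t + chordIntercept m M q = M ^ q + chordSlope m M q * (t - M) := by
  have : M - m ≠ 0 := (sub_pos.2 h).ne'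
  unfold chordSlope chordIntercept
  field_simp
  ring

theorem rpow_le_chord {m M q t : ℝ} (hq : q < 0 ∨ 1 ≤ q) (hm : 0 < m) (hmM : m < M)
    (ht : t ∈ Set.Icc m M) :
    t ^ q ≤ chordSlope m M q * t + chordIntercept m M q := by
  have ht0 : 0 < t := hm.trans_le ht.1
  rw [chord_eq_weighted_average, le_div_iff₀ (sub_pos.2 hmM)]
  have h1 := mul_le_mul_of_nonneg_left (rpow_tangent_le hq ht0 hm) (sub_nonneg.2 ht.2)
  have h2 := mul_le_mul_of_nonneg_left (rpow_tangent_le hq ht0 (hm.trans hmM))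
    (sub_nonneg.2 ht.1)
  linarith

theorem chord_le_mul_rpow_add_gammaConst {m M q α t : ℝ} (hq : q < 0) (hm : 0 < m)
    (hmM : m < M) (hα : 0 < α) (ht : t ∈ Set.Icc m M) :
    chordSlope m M q * t + chordIntercept m M q ≤ α * t ^ q + gammaConst m M q α := by
  have ht0 : 0 < t := hm.trans_le ht.1
  have hM : 0 < M := hm.trans hmM
  set u : ℝ := (M ^ q - m ^ q) / (α * q * (M - m)) with hu
  have hslope : chordSlope m M q = α * q * u := by
    have : M - m ≠ 0 := (sub_pos.2 hmM).ne'
    have := hq.ne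
    rw [hu, chordSlope]
    field_simp
  have hu0 : 0 < u := by
    refine div_pos_of_neg_of_neg (sub_neg.2 (Real.rpow_lt_rpow_of_neg hm hmM hq)) ?_
    exact mul_neg_of_neg_of_pos (mul_neg_of_pos_of_neg hα hq) (sub_pos.2 hmM)
  set t₀ : ℝ := u ^ (1 / (q - 1)) with ht₀
  have ht₀0 : 0 < t₀ := Real.rpow_pos_of_pos hu0 _
  have ht₀u : t₀ ^ (q - 1) = u := by
    rw [ht₀, ← Real.rpow_mul hu0.le, one_div_mul_cancel (by linarith), Real.rpow_one]
  have ht₀q : u ^ (q / (q - 1)) = t₀ ^ q := by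
    rw [ht₀, ← Real.rpow_mul hu0.le]
    congr 1
    ring
  have tangent : ∀ s : ℝ, 0 < s → α * (s ^ q + q * s ^ (q - 1) * (t - s)) ≤ α * t ^ q :=
    fun s hs ↦ mul_le_mul_of_nonneg_left (rpow_tangent_le (.inl hq) hs ht0) hα.le
  have hαq : α * q < 0 := mul_neg_of_pos_of_neg hα hq
  unfold gammaConst
  rw [← hu, ← ht₀, ht₀q]
  split_ifs with h1 h2
  · have h := tangent t₀ ht₀0
    have hpow : u * t₀ = t₀ ^ q := by
      rw [← ht₀u, Real.rpow_sub_one ht₀0.ne']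
      field_simp
    rw [ht₀u] at h
    rw [hslope, ← chordIntercept]
    nlinarith
  · have h := tangent M hM
    have hle : t₀ ^ (q - 1) ≤ M ^ (q - 1) :=
      Real.rpow_le_rpow_of_nonpos hM h2 (by linarith)
    rw [ht₀u] at hle
    rw [chord_eq_right hmM, hslope]
    nlinarith [mul_nonneg (mul_nonneg (neg_nonneg.2 hαq.le) (sub_nonneg.2 hle))
      (sub_nonneg.2 ht.2)]
  · have h := tangent m hm
    have h3 : t₀ ≤ m := by
      by_contra! h3
      exact h1 ⟨h3.le, (not_le.1 h2).le⟩
    have hle : m ^ (q - 1) ≤ t₀ ^ (q - 1) :=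
      Real.rpow_le_rpow_of_nonpos ht₀0 h3 (by linarith)
    rw [ht₀u] at hle
    rw [chord_eq_left hmM, hslope]
    nlinarith [mul_nonneg (mul_nonneg (neg_nonneg.2 hαq.le) (sub_nonneg.2 hle))
      (sub_nonneg.2 ht.1)]

theorem chordSlope_nonneg {m M p : ℝ} (hp : 0 ≤ p) (hm : 0 < m) (hmM : m < M) :
    0 ≤ chordSlope m M p :=
  div_nonneg (sub_nonneg.2 (Real.rpow_le_rpow hm.le hmM.le hp)) (sub_pos.2 hmM).le

theorem Kconst_pos {h p : ℝ} (hh : 1 < h) (hp : 1 ≤ p) : 0 < Kconst h p := by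
  unfold Kconst
  split_ifs with hp1
  · exact one_pos
  · have hp' : 1 < p := lt_of_le_of_ne hp fun h ↦ hp1 (.inr h.symm)
    have h1 : 0 < h ^ p - h := sub_pos.2 (Real.self_lt_rpow_of_one_lt hh hp')
    have h2 : 0 < h ^ p - 1 := by linarith
    have h3 : 0 < p - 1 := by linarith
    have h4 : 0 < h - 1 := by linarith
    positivity

theorem chord_le_Kconst_mul_rpow {m M p t : ℝ} (hp : 1 ≤ p) (hm : 0 < m) (hmM : m < M)
    (ht : 0 < t) :
    chordSlope m M p * t + chordIntercept m M p ≤ Kconst (M / m) p * t ^ p := by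
  have hMm : 0 < M - m := sub_pos.2 hmM
  rcases hp.eq_or_lt with rfl | hp1
  · simp only [chordSlope, chordIntercept, Kconst, Real.rpow_one]
    field_simp
    simp
  obtain ⟨h, rfl⟩ : ∃ h, M = h * m := ⟨M / m, by field_simp⟩
  have hh : 1 < h := by nlinarith
  have hh0 : 0 < h := by linarith
  rw [mul_div_cancel_right₀ _ hm.ne']
  have h1 : 0 < h ^ p - h := sub_pos.2 (Real.self_lt_rpow_of_one_lt hh hp1)
  have h2 : 0 < h ^ p - 1 := by linarith
  have h3 : 0 < p - 1 := by linarith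
  have h4 : 0 < h - 1 := by linarith
  have hmp : 0 < m ^ p := Real.rpow_pos_of_pos hm p
  set w : ℝ := (p - 1) / p * ((h ^ p - 1) / (h ^ p - h)) with hw
  have hw0 : 0 < w := by positivity
  have hK : Kconst h p = (h ^ p - h) / ((p - 1) * (h - 1)) * w ^ p := by
    rw [Kconst, if_neg (by rintro (h | h) <;> linarith)]
  have hKpos : 0 < Kconst h p := Kconst_pos hh hp
  have hs : 0 < m / w := by positivity
  have hsp : Kconst h p * (m / w) ^ p = (h ^ p - h) / ((p - 1) * (h - 1)) * m ^ p := by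
    rw [hK, Real.div_rpow hm.le hw0.le]
    have := (Real.rpow_pos_of_pos hw0 p).ne'
    field_simp
  have tangent := mul_le_mul_of_nonneg_left (rpow_tangent_le (.inr hp) hs ht) hKpos.le
  refine le_of_eq_of_le ?_ tangent
  rw [Real.rpow_sub_one hs.ne']
  trans (Kconst h p * (m / w) ^ p) * (1 + p * (t / (m / w) - 1))
  · rw [hsp, chordSlope, chordIntercept, Real.mul_rpow hh0.le hm.le, hw]
    have : h * m - m ≠ 0 := hMm.ne'
    have e : h * m - m = (h - 1) * m := by ring
    rw [e]
    field_simp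
    ring
  · field_simp

end Scalar

section Operator

variable {𝔸 : Type*} [CStarAlgebra 𝔸]

theorem cfc_const_mul_add_const {f : ℝ → ℝ} {T : 𝔸} (hT : IsSelfAdjoint T)
    (hf : ContinuousOn f (spectrum ℝ T)) (s c : ℝ) :
    cfc (fun x ↦ s * f x + c) T = s • cfc f T + c • (1 : 𝔸) := by
  rw [cfc_add_const c (fun x ↦ s * f x) T (by fun_prop) hT, cfc_const_mul s f T hf,
    Algebra.algebraMap_eq_smul_one]

variable [PartialOrder 𝔸] [StarOrderedRing 𝔸]

theorem nonneg_of_smul_one_le_s9 {a : ℝ} {T : 𝔸} (ha : 0 < a) (h : a • (1 : 𝔸) ≤ T) : 0 ≤ T :=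
  (smul_nonneg ha.le zero_le_one).trans h

theorem isUnit_of_smul_one_le_s9 {a : ℝ} {T : 𝔸} (ha : 0 < a) (h : a • (1 : 𝔸) ≤ T) :
    IsUnit T := by
  refine CStarAlgebra.isUnit_of_le (a • (1 : 𝔸)) h ?_
  have : IsStrictlyPositive (1 : 𝔸) := by grind
  exact this.smul ha

theorem le_of_mem_spectrum_s9 {a x : ℝ} {T : 𝔸} (hT : IsSelfAdjoint T) (h : a • (1 : 𝔸) ≤ T)
    (hx : x ∈ spectrum ℝ T) : a ≤ x := by
  rw [← Algebra.algebraMap_eq_smul_one] at h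
  exact (algebraMap_le_iff_le_spectrum hT).1 h x hx

theorem mem_spectrum_le {b x : ℝ} {T : 𝔸} (hT : IsSelfAdjoint T) (h : T ≤ b • (1 : 𝔸))
    (hx : x ∈ spectrum ℝ T) : x ≤ b := by
  rw [← Algebra.algebraMap_eq_smul_one] at h
  exact (le_algebraMap_iff_spectrum_le hT).1 h x hx

theorem continuousOn_rpow_spectrum_s9 {a : ℝ} {T : 𝔸} (ha : 0 < a) (h : a • (1 : 𝔸) ≤ T)
    (r : ℝ) : ContinuousOn (fun x : ℝ ↦ x ^ r) (spectrum ℝ T) := by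
  have hT := (nonneg_of_smul_one_le_s9 ha h).isSelfAdjoint
  exact fun x hx ↦ (Real.continuousAt_rpow_const x r
    (.inl (ha.trans_le (le_of_mem_spectrum_s9 hT h hx)).ne')).continuousWithinAt

theorem continuousOn_inv_spectrum_s9 {a : ℝ} {T : 𝔸} (ha : 0 < a) (h : a • (1 : 𝔸) ≤ T) :
    ContinuousOn (fun x : ℝ ↦ x⁻¹) (spectrum ℝ T) := by
  have hT := (nonneg_of_smul_one_le_s9 ha h).isSelfAdjoint
  exact continuousOn_id.inv₀ fun x hx ↦ (ha.trans_le (le_of_mem_spectrum_s9 hT h hx)).ne'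

theorem ringInverse_eq_cfc {a : ℝ} {T : 𝔸} (ha : 0 < a) (h : a • (1 : 𝔸) ≤ T) :
    Ring.inverse T = cfc (fun x : ℝ ↦ x⁻¹) T :=
  (cfc_ringInverse_id (R := ℝ) T (isUnit_of_smul_one_le_s9 ha h)
    (nonneg_of_smul_one_le_s9 ha h).isSelfAdjoint).symm

theorem rpow_eq_cfc {a : ℝ} {T : 𝔸} (ha : 0 < a) (h : a • (1 : 𝔸) ≤ T) (r : ℝ) :
    CFC.rpow T r = cfc (fun x : ℝ ↦ x ^ r) T :=
  CFC.rpow_eq_cfc_real (nonneg_of_smul_one_le_s9 ha h)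

theorem inv_smul_one_le_ringInverse {a b : ℝ} {T : 𝔸} (ha : 0 < a)
    (h1 : a • (1 : 𝔸) ≤ T) (h2 : T ≤ b • (1 : 𝔸)) : b⁻¹ • (1 : 𝔸) ≤ Ring.inverse T := by
  have hT := (nonneg_of_smul_one_le_s9 ha h1).isSelfAdjoint
  rw [ringInverse_eq_cfc ha h1, ← Algebra.algebraMap_eq_smul_one]
  exact algebraMap_le_cfc _ _ T (fun x hx ↦ inv_anti₀
    (ha.trans_le (le_of_mem_spectrum_s9 hT h1 hx)) (mem_spectrum_le hT h2 hx))
    (continuousOn_inv_spectrum_s9 ha h1) hT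

theorem ringInverse_le_inv_smul_one {a : ℝ} {T : 𝔸} (ha : 0 < a)
    (h1 : a • (1 : 𝔸) ≤ T) : Ring.inverse T ≤ a⁻¹ • (1 : 𝔸) := by
  have hT := (nonneg_of_smul_one_le_s9 ha h1).isSelfAdjoint
  rw [ringInverse_eq_cfc ha h1, ← Algebra.algebraMap_eq_smul_one]
  exact cfc_le_algebraMap _ _ T (fun x hx ↦ inv_anti₀ ha (le_of_mem_spectrum_s9 hT h1 hx))
    (continuousOn_inv_spectrum_s9 ha h1) hT

theorem smul_one_le_rpow {a r : ℝ} {T : 𝔸} (ha : 0 < a) (hr : 0 ≤ r)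
    (h : a • (1 : 𝔸) ≤ T) : a ^ r • (1 : 𝔸) ≤ CFC.rpow T r := by
  have hT := (nonneg_of_smul_one_le_s9 ha h).isSelfAdjoint
  rw [rpow_eq_cfc ha h, ← Algebra.algebraMap_eq_smul_one]
  exact algebraMap_le_cfc _ _ T
    (fun x hx ↦ Real.rpow_le_rpow ha.le (le_of_mem_spectrum_s9 hT h hx) hr)
    (continuousOn_rpow_spectrum_s9 ha h r) hT

theorem inv_mem_Icc {a b x : ℝ} (ha : 0 < a) (hx : x ∈ Set.Icc a b) :
    x⁻¹ ∈ Set.Icc (1 / b) (1 / a) := by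
  simp only [one_div]
  exact ⟨inv_anti₀ (ha.trans_le hx.1) hx.2, inv_anti₀ ha hx.1⟩

/-- The chord bound for `t ↦ t ^ (-r)` on `[1 / b, 1 / a]`, evaluated at `T⁻¹`. -/
theorem rpow_le_chord_ringInverse {a b r : ℝ} {T : 𝔸} (ha : 0 < a) (hab : a < b)
    (hr : 0 < r) (h1 : a • (1 : 𝔸) ≤ T) (h2 : T ≤ b • (1 : 𝔸)) :
    CFC.rpow T r ≤ chordSlope (1 / b) (1 / a) (-r) • Ring.inverse T +
      chordIntercept (1 / b) (1 / a) (-r) • (1 : 𝔸) := by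
  have hT := (nonneg_of_smul_one_le_s9 ha h1).isSelfAdjoint
  have hinv := continuousOn_inv_spectrum_s9 ha h1
  rw [rpow_eq_cfc ha h1, ringInverse_eq_cfc ha h1, ← cfc_const_mul_add_const hT hinv]
  refine cfc_mono (fun x hx ↦ ?_) (continuousOn_rpow_spectrum_s9 ha h1 r) (by fun_prop)
  have hx' : x ∈ Set.Icc a b := ⟨le_of_mem_spectrum_s9 hT h1 hx, mem_spectrum_le hT h2 hx⟩
  have hx0 : 0 < x := ha.trans_le hx'.1
  have := rpow_le_chord (q := -r) (.inl (by linarith)) (one_div_pos.2 (ha.trans hab))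
    (one_div_lt_one_div_of_lt ha hab) (inv_mem_Icc ha hx')
  rwa [Real.rpow_neg (inv_nonneg.2 hx0.le), Real.inv_rpow hx0.le, inv_inv] at this

theorem chord_ringInverse_le {a b r β : ℝ} {T : 𝔸} (ha : 0 < a) (hab : a < b)
    (hr : 0 < r) (hβ : 0 < β) (h1 : a • (1 : 𝔸) ≤ T) (h2 : T ≤ b • (1 : 𝔸)) :
    chordSlope (1 / b) (1 / a) (-r) • Ring.inverse T +
      chordIntercept (1 / b) (1 / a) (-r) • (1 : 𝔸) ≤
      β • CFC.rpow T r + gammaConst (1 / b) (1 / a) (-r) β • (1 : 𝔸) := by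
  have hT := (nonneg_of_smul_one_le_s9 ha h1).isSelfAdjoint
  have hinv := continuousOn_inv_spectrum_s9 ha h1
  have hpow := continuousOn_rpow_spectrum_s9 ha h1 r
  rw [rpow_eq_cfc ha h1, ringInverse_eq_cfc ha h1, ← cfc_const_mul_add_const hT hinv,
    ← cfc_const_mul_add_const hT hpow]
  refine cfc_mono (fun x hx ↦ ?_) (by fun_prop) (by fun_prop)
  have hx' : x ∈ Set.Icc a b := ⟨le_of_mem_spectrum_s9 hT h1 hx, mem_spectrum_le hT h2 hx⟩
  have hx0 : 0 < x := ha.trans_le hx'.1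
  have := chord_le_mul_rpow_add_gammaConst (q := -r) (by linarith)
    (one_div_pos.2 (ha.trans hab)) (one_div_lt_one_div_of_lt ha hab) hβ (inv_mem_Icc ha hx')
  rwa [Real.rpow_neg (inv_nonneg.2 hx0.le), Real.inv_rpow hx0.le, inv_inv] at this

/-- Furuta's Kantorovich-type inequality: the power `p ≥ 1` is order preserving up to the
generalized Kantorovich constant. -/
theorem rpow_le_Kconst_smul_rpow {a b p : ℝ} {S T : 𝔸} (ha : 0 < a) (hab : a < b)
    (hp : 1 ≤ p) (h1 : a • (1 : 𝔸) ≤ S) (h2 : S ≤ b • (1 : 𝔸)) (hST : S ≤ T) :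
    CFC.rpow S p ≤ Kconst (b / a) p • CFC.rpow T p := by
  have h3 := h1.trans hST
  have hS := (nonneg_of_smul_one_le_s9 ha h1).isSelfAdjoint
  have hT := (nonneg_of_smul_one_le_s9 ha h3).isSelfAdjoint
  calc CFC.rpow S p ≤ chordSlope a b p • S + chordIntercept a b p • (1 : 𝔸) := by
        nth_rw 2 [← cfc_id' ℝ S hS]
        rw [rpow_eq_cfc ha h1, ← cfc_const_mul_add_const hS (continuousOn_id' _)]
        exact cfc_mono (fun x hx ↦ rpow_le_chord (.inr hp) ha hab
          ⟨le_of_mem_spectrum_s9 hS h1 hx, mem_spectrum_le hS h2 hx⟩)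
          (continuousOn_rpow_spectrum_s9 ha h1 p) (by fun_prop)
    _ ≤ chordSlope a b p • T + chordIntercept a b p • (1 : 𝔸) := by
        gcongr
        exact chordSlope_nonneg (by linarith) ha hab
    _ ≤ Kconst (b / a) p • CFC.rpow T p := by
        have hpow := continuousOn_rpow_spectrum_s9 ha h3 p
        nth_rw 1 [← cfc_id' ℝ T hT]
        rw [rpow_eq_cfc ha h3, ← cfc_const_mul_add_const hT (continuousOn_id' _),
          ← cfc_const_mul _ _ T hpow]
        exact cfc_mono (fun x hx ↦ chord_le_Kconst_mul_rpow hp ha hab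
          (ha.trans_le (le_of_mem_spectrum_s9 hT h3 hx))) (by fun_prop) (by fun_prop)

end Operator

theorem stmt9
    {H K : Type*}
    [NormedAddCommGroup H] [InnerProductSpace ℂ H] [CompleteSpace H]
    [NormedAddCommGroup K] [InnerProductSpace ℂ K] [CompleteSpace K]
    {n : ℕ} (ω : Fin n → ℝ) (hω0 : ∀ j, 0 ≤ ω j) (hω1 : ∑ j, ω j = 1)
    (m M : ℝ) (hm : 0 < m) (hmM : m < M)
    (A : Fin n → (H →L[ℂ] H))
    (hA0 : ∀ j, 0 ≤ A j) (hAu : ∀ j, IsUnit (A j))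
    (hA1 : ∀ j, m • (1 : H →L[ℂ] H) ≤ A j)
    (hA2 : ∀ j, A j ≤ M • (1 : H →L[ℂ] H))
    (Φ : (H →L[ℂ] H) →ₗ[ℂ] (K →L[ℂ] K))
    (hΦ1 : Φ 1 = 1) (hΦpos : ∀ T : H →L[ℂ] H, 0 ≤ T → 0 ≤ Φ T)
    (F : (Fin n → (H →L[ℂ] H)) → (H →L[ℂ] H))
    (G : (Fin n → (K →L[ℂ] K)) → (K →L[ℂ] K))
    (hF : IsAHSandwich ω F) (hG : IsAHSandwich ω G)
    (α : ℝ) (hα : 0 < α) (r : ℝ) (hr : 1 ≤ r)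
    :
    G (fun j => Φ (CFC.rpow (A j) r)) ≤
      α • Φ (CFC.rpow (F A) r) +
        gammaConst (1 / M) (1 / m) (-r) (α * (Kconst (M / m) r)⁻¹) • (1 : K →L[ℂ] K) := by
  have hM : 0 < M := hm.trans hmM
  have hr0 : 0 < r := by linarith
  have hK : 0 < Kconst (M / m) r := Kconst_pos ((one_lt_div hm).2 hmM) hr
  have hβ : 0 < α * (Kconst (M / m) r)⁻¹ := by positivity
  have map_smul_real : ∀ (c : ℝ) (T : H →L[ℂ] H), Φ (c • T) = c • Φ T :=
    fun c T ↦ Φ.map_smul_of_tower c T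
  have hΦmono : ∀ {S T : H →L[ℂ] H}, S ≤ T → Φ S ≤ Φ T := fun {S T} h ↦ by
    have := hΦpos _ (sub_nonneg.2 h)
    rwa [map_sub, sub_nonneg] at this
  have hΦpow : ∀ j, m ^ r • (1 : K →L[ℂ] K) ≤ Φ (CFC.rpow (A j) r) := fun j ↦ by
    have := hΦmono (smul_one_le_rpow hm hr0.le (hA1 j))
    rwa [map_smul_real, hΦ1] at this
  have hmr : 0 < m ^ r := Real.rpow_pos_of_pos hm r
  have sum_const : ∀ c : ℝ, ∑ j, ω j • c • (1 : H →L[ℂ] H) = c • 1 := fun c ↦ by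
    rw [← Finset.sum_smul, hω1, one_smul]
  set X : H →L[ℂ] H := ∑ j, ω j • Ring.inverse (A j) with hX
  have hX1 : M⁻¹ • (1 : H →L[ℂ] H) ≤ X := by
    rw [← sum_const]
    exact Finset.sum_le_sum fun j _ ↦ smul_le_smul_of_nonneg_left
      (inv_smul_one_le_ringInverse hm (hA1 j) (hA2 j)) (hω0 j)
  have hX2 : X ≤ m⁻¹ • (1 : H →L[ℂ] H) := by
    rw [← sum_const]
    exact Finset.sum_le_sum fun j _ ↦ smul_le_smul_of_nonneg_left
      (ringInverse_le_inv_smul_one hm (hA1 j)) (hω0 j)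
  have hMinv : 0 < M⁻¹ := inv_pos.2 hM
  set Y : H →L[ℂ] H := Ring.inverse X with hY
  have hY1 : m • (1 : H →L[ℂ] H) ≤ Y := by
    simpa using inv_smul_one_le_ringInverse hMinv hX1 hX2
  have hY2 : Y ≤ M • (1 : H →L[ℂ] H) := by
    simpa using ringInverse_le_inv_smul_one hMinv hX1
  have hYX : Ring.inverse Y = X := Ring.inverse_inverse (isUnit_of_smul_one_le_s9 hMinv hX1)
  have hYF : Y ≤ F A := (hF A hA0 hAu).2.1
  have hsum : ∑ j, ω j • CFC.rpow (A j) r ≤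
      α • CFC.rpow (F A) r +
        gammaConst (1 / M) (1 / m) (-r) (α * (Kconst (M / m) r)⁻¹) • (1 : H →L[ℂ] H) :=
    calc ∑ j, ω j • CFC.rpow (A j) r
        ≤ ∑ j, ω j • (chordSlope (1 / M) (1 / m) (-r) • Ring.inverse (A j) +
            chordIntercept (1 / M) (1 / m) (-r) • (1 : H →L[ℂ] H)) :=
          Finset.sum_le_sum fun j _ ↦ smul_le_smul_of_nonneg_left
            (rpow_le_chord_ringInverse hm hmM hr0 (hA1 j) (hA2 j)) (hω0 j)
      _ = chordSlope (1 / M) (1 / m) (-r) • Ring.inverse Y +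
            chordIntercept (1 / M) (1 / m) (-r) • (1 : H →L[ℂ] H) := by
          simp_rw [smul_add]
          rw [Finset.sum_add_distrib, sum_const, hYX, hX, Finset.smul_sum]
          simp_rw [smul_comm (chordSlope _ _ _)]
      _ ≤ _ := chord_ringInverse_le hm hmM hr0 hβ hY1 hY2
      _ ≤ _ := by
          gcongr
          have := smul_le_smul_of_nonneg_left
            (rpow_le_Kconst_smul_rpow hm hmM hr hY1 hY2 hYF) hβ.le
          rwa [smul_smul, inv_mul_cancel_right₀ hK.ne'] at this
  calc G (fun j => Φ (CFC.rpow (A j) r))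
      ≤ ∑ j, ω j • Φ (CFC.rpow (A j) r) :=
        (hG _ (fun j ↦ nonneg_of_smul_one_le_s9 hmr (hΦpow j))
          (fun j ↦ isUnit_of_smul_one_le_s9 hmr (hΦpow j))).2.2
    _ = Φ (∑ j, ω j • CFC.rpow (A j) r) := by simp_rw [map_sum, map_smul_real]
    _ ≤ _ := hΦmono hsum
    _ = _ := by rw [map_add, map_smul_real, map_smul_real, hΦ1]
end
end
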